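/- arXiv:2507.09775 — 3 statements merged into one kernel-verified Lean document; each statement's English description precedes it below -/
import Mathlib

section
/- Let m ≥ 5 be an odd integer and set ρ = exp(2πi/m) ∈ ℂ. Then the 2×2 complex matrix M = [[1, 0], [1+ρ⁻¹, ρ⁻¹]] · [[ρ, 1+ρ], [0, 1]] has infinite order: M^k ≠ I for every integer k ≥ 1. (Indeed, M has determinant 1 and real trace 2 + 4·cos(2π/m) > 2, hence a real eigenvalue strictly greater than 1.) -/
noncomputable section

theorem Matrix.pow_mulVec_eq_smul {n R : Type*} [Fintype n] [DecidableEq n] [CommRing R]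
    {A : Matrix n n R} {v : n → R} {c : R} (h : A.mulVec v = c • v) (k : ℕ) :
    (A ^ k).mulVec v = c ^ k • v := by
  induction k with
  | zero => simp
  | succ k ih => rw [pow_succ, ← Matrix.mulVec_mulVec, h, Matrix.mulVec_smul, ih, smul_smul, pow_succ']

theorem exists_one_lt_sq_eq {t : ℝ} (ht : 2 < t) : ∃ x : ℝ, 1 < x ∧ x ^ 2 = t * x - 1 := by
  have hs : √(t ^ 2 - 4) ^ 2 = t ^ 2 - 4 := Real.sq_sqrt (by nlinarith)
  have h0 := Real.sqrt_nonneg (t ^ 2 - 4)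
  exact ⟨(t + √(t ^ 2 - 4)) / 2, by linarith, by linear_combination hs / 4⟩

/-- Let `m ≥ 5` be odd and `ρ = exp(2πi/m)`. Then the matrix
`M = [[1, 0], [1+ρ⁻¹, ρ⁻¹]] · [[ρ, 1+ρ], [0, 1]]` has infinite order: `M^k ≠ I` for every
integer `k ≥ 1`. -/
theorem stmt_8 (m : ℕ) (hm : 5 ≤ m) (hodd : Odd m) (ρ : ℂ)
    (hρ : ρ = Complex.exp (2 * Real.pi * Complex.I / m)) :
    ∀ k : ℕ, 1 ≤ k →
      ((!![1, 0; 1 + ρ⁻¹, ρ⁻¹] : Matrix (Fin 2) (Fin 2) ℂ) *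
        (!![ρ, 1 + ρ; 0, 1] : Matrix (Fin 2) (Fin 2) ℂ)) ^ k ≠ 1 := by
  intro k hk hM
  have hm' : (5 : ℝ) ≤ m := by exact_mod_cast hm
  have hρ' : ρ = Complex.exp ((2 * Real.pi / m : ℝ) * Complex.I) := by
    rw [hρ]
    push_cast
    ring_nf
  have hnorm : ‖ρ‖ = 1 := by rw [hρ', Complex.norm_exp_ofReal_mul_I]
  have hρ0 : ρ ≠ 0 := hρ ▸ Complex.exp_ne_zero _
  have hcos : 0 < Real.cos (2 * Real.pi / m) := by
    have hpi := Real.pi_pos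
    apply Real.cos_pos_of_mem_Ioo
    constructor
    · have : 0 ≤ 2 * Real.pi / m := by positivity
      linarith
    · rw [div_lt_iff₀ (by linarith)]
      nlinarith
  have hsum : ρ + ρ⁻¹ = 2 * (Real.cos (2 * Real.pi / m) : ℂ) := by
    rw [hρ', ← Complex.exp_neg, Complex.ofReal_cos, Complex.two_cos, neg_mul]
  obtain ⟨x, hx, hxt⟩ := exists_one_lt_sq_eq
    (show 2 < 2 + 4 * Real.cos (2 * Real.pi / m) by linarith)
  have hxc : (x : ℂ) ^ 2 = (2 + 2 * (ρ + ρ⁻¹)) * x - 1 := by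
    rw [hsum]
    have := congrArg (fun y : ℝ => (y : ℂ)) hxt
    push_cast at this ⊢
    linear_combination this
  have hne : (x : ℂ) - ρ ≠ 0 := by
    intro h
    have h' := congrArg norm (sub_eq_zero.mp h)
    rw [hnorm, Complex.norm_real, Real.norm_eq_abs, abs_of_pos (by linarith)] at h'
    linarith
  have hinv : ρ * ρ⁻¹ = 1 := mul_inv_cancel₀ hρ0
  have heig : ((!![1, 0; 1 + ρ⁻¹, ρ⁻¹] : Matrix (Fin 2) (Fin 2) ℂ) *
      !![ρ, 1 + ρ; 0, 1]).mulVec ![1 + ρ, x - ρ] = (x : ℂ) • ![1 + ρ, x - ρ] := by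
    ext i
    fin_cases i
    · simp [Matrix.mulVec, dotProduct, Fin.sum_univ_two]
      ring
    · simp [Matrix.mulVec, dotProduct, Fin.sum_univ_two]
      linear_combination (x - 1) * hinv - hxc
  have hpow := Matrix.pow_mulVec_eq_smul heig k
  rw [hM, Matrix.one_mulVec] at hpow
  have h1 : (x : ℂ) - ρ = x ^ k * (x - ρ) := by simpa using congrFun hpow 1
  have h2 : (x : ℂ) ^ k = 1 := mul_right_cancel₀ hne (by rw [one_mul, ← h1])
  have h3 : x ^ k = 1 := by exact_mod_cast h2
  exact (one_lt_pow₀ hx (by omega)).ne' h3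
end
end

section
/- Let X be a locally compact, second-countable metric space, let φ : ℝ × X → X be a continuous flow (φ(0, x) = x and φ(s+t, x) = φ(s, φ(t, x)) for all s, t ∈ ℝ, x ∈ X), and let μ be a Borel probability measure on X that is invariant under φ_s for every s ∈ ℝ and ergodic (every Borel set A with φ_s⁻¹(A) = A for all s ∈ ℝ has μ(A) ∈ {0, 1}). Then for every ε > 0 there exist T > 0 and a continuous compactly supported function ψ : X → [0, 1] with ∫ ψ dμ > 1 − ε, such that for every x ∈ X with ψ(x) > 0, the occupation measure ν_{x,T} — the pushforward under s ↦ φ(s, x) of (1/T) times Lebesgue measure restricted to [0, T] — satisfies d_LP(ν_{x,T}, μ) < ε, where d_LP denotes the Lévy–Prokhorov distance between Borel probability measures on X. -/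
noncomputable section

open MeasureTheory Filter Topology

/-- Mean ergodic theorem, in the form of convergence in measure: the Birkhoff averages of a
square-integrable function under a measure-preserving map converge in measure. -/
theorem exists_tendstoInMeasure_birkhoffAverage {α : Type*} [MeasurableSpace α] {μ : Measure α}
    {S : α → α} (hS : MeasurePreserving S μ μ) {g : α → ℝ} (hg : MemLp g 2 μ) :
    ∃ h : α → ℝ, TendstoInMeasure μ (birkhoffAverage ℝ S g) atTop h := by
  let U : Lp ℝ 2 μ →L[ℝ] Lp ℝ 2 μ :=
    (Lp.compMeasurePreservingₗᵢ ℝ S hS).toContinuousLinearMap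
  have hU : ‖U‖ ≤ 1 := LinearIsometry.norm_toContinuousLinearMap_le _
  have h_iter (k : ℕ) : (U^[k] (hg.toLp g) : α → ℝ) =ᵐ[μ] fun x => g (S^[k] x) := by
    induction k with
    | zero => exact hg.coeFn_toLp
    | succ k ih =>
      rw [Function.iterate_succ_apply']
      refine (Lp.coeFn_compMeasurePreserving (U^[k] (hg.toLp g)) hS).trans ?_
      exact hS.quasiMeasurePreserving.ae_eq_comp ih
  have hsum (n : ℕ) : ((birkhoffSum U id n (hg.toLp g) : Lp ℝ 2 μ) : α → ℝ) =ᵐ[μ] birkhoffSum S g n := by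
    induction n with
    | zero =>
      simp only [birkhoffSum_zero']
      exact Lp.coeFn_zero ℝ 2 μ
    | succ n ih =>
      rw [birkhoffSum_succ]
      filter_upwards [Lp.coeFn_add (birkhoffSum U id n (hg.toLp g)) (id (U^[n] (hg.toLp g))),
        ih, h_iter n] with x h₁ h₂ h₃
      simp only [id_eq] at h₁ ⊢
      rw [h₁, Pi.add_apply, h₂, h₃, birkhoffSum_succ]
  have havg (n : ℕ) :
      ((birkhoffAverage ℝ U id n (hg.toLp g) : Lp ℝ 2 μ) : α → ℝ) =ᵐ[μ]
        birkhoffAverage ℝ S g n := by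
    filter_upwards [Lp.coeFn_smul (n : ℝ)⁻¹ (birkhoffSum U id n (hg.toLp g)), hsum n]
      with x h₁ h₂
    simp [birkhoffAverage, h₁, h₂]
  exact ⟨_, (tendstoInMeasure_of_tendsto_Lp
    (U.tendsto_birkhoffAverage_orthogonalProjection hU (hg.toLp g))).congr_left havg⟩

/-- If, for every bounded continuous `f`, the integrals of `f` against random probability measures
`P i` converge in measure to `∫ f dμ₀`, then `P i` converges to `μ₀` in probability. -/
theorem tendsto_measure_notMem_of_forall_tendstoInMeasure {α ι X : Type*} [MeasurableSpace α]
    {μ : Measure α} [MeasurableSpace X] [TopologicalSpace X] [OpensMeasurableSpace X]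
    {l : Filter ι} {P : ι → α → ProbabilityMeasure X} {μ₀ : ProbabilityMeasure X}
    (h : ∀ f : BoundedContinuousFunction X ℝ,
      TendstoInMeasure μ (fun i a => ∫ x, f x ∂(P i a : Measure X)) l
        (fun _ => ∫ x, f x ∂(μ₀ : Measure X)))
    {D : Set (ProbabilityMeasure X)} (hD : D ∈ 𝓝 μ₀) :
    Tendsto (fun i => μ {a | P i a ∉ D}) l (𝓝 0) := by
  let F : Filter (ProbabilityMeasure X) :=
    { sets := {E | Tendsto (fun i => μ {a | P i a ∉ E}) l (𝓝 0)}
      univ_sets := by simp [tendsto_const_nhds]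
      sets_of_superset := fun {E E'} hE hEE' =>
        tendsto_of_tendsto_of_tendsto_of_le_of_le tendsto_const_nhds hE (fun _ => zero_le)
          fun i => measure_mono fun a ha ha' => ha (hEE' ha')
      inter_sets := fun {E E'} hE hE' => by
        have hadd := Tendsto.add hE hE'
        rw [add_zero] at hadd
        refine tendsto_of_tendsto_of_tendsto_of_le_of_le tendsto_const_nhds hadd
          (fun _ => zero_le) fun i => (measure_mono fun a ha => ?_).trans (measure_union_le _ _)
        by_cases haE : P i a ∈ E
        · exact Or.inr fun haE' => ha ⟨haE, haE'⟩
        · exact Or.inl haE }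
  have hF : Tendsto id F (𝓝 μ₀) := by
    rw [ProbabilityMeasure.tendsto_iff_forall_integral_tendsto]
    intro f
    rw [Metric.tendsto_nhds]
    intro δ hδ
    have := tendstoInMeasure_iff_dist.1 (h f) δ hδ
    change Tendsto _ _ _
    simpa only [Set.mem_ofPred_eq, id_eq, not_lt] using this
  exact hF hD

/-- The average of `f` along the orbit segment of `x` of length `T`. -/
def orbitAverage {X : Type*} (φ : ℝ × X → X) (f : X → ℝ) (T : ℝ) (x : X) : ℝ :=
  T⁻¹ * ∫ s in (0 : ℝ)..T, f (φ (s, x))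

theorem abs_orbitAverage_le {X : Type*} {φ : ℝ × X → X} {f : X → ℝ} {C : ℝ} (hC : 0 ≤ C)
    (hf : ∀ x, |f x| ≤ C) (T : ℝ) (x : X) : |orbitAverage φ f T x| ≤ C := by
  rcases eq_or_ne T 0 with rfl | hT
  · simpa [orbitAverage] using hC
  · have h := intervalIntegral.norm_integral_le_of_norm_le_const (a := 0) (b := T)
      (f := fun s => f (φ (s, x))) (C := C) fun s _ => hf _
    rw [sub_zero, Real.norm_eq_abs] at h
    rw [orbitAverage, abs_mul, abs_inv, inv_mul_le_iff₀ (abs_pos.2 hT)]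
    linarith

section Flow

variable {X : Type*} [MetricSpace X] {φ : ℝ × X → X}

theorem continuous_orbitAverage (hφ : Continuous φ) {f : X → ℝ} (hf : Continuous f) (T : ℝ) :
    Continuous (orbitAverage φ f T) := by
  unfold orbitAverage
  refine continuous_const.mul
    (intervalIntegral.continuous_parametric_intervalIntegral_of_continuous' ?_ 0 T)
  fun_prop

theorem birkhoffAverage_eq_orbitAverage (hφ_cont : Continuous φ) (hφ_zero : ∀ x, φ (0, x) = x)
    (hφ_add : ∀ s t x, φ (s + t, x) = φ (s, φ (t, x))) {f : X → ℝ} (hf : Continuous f) (n : ℕ) :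
    birkhoffAverage ℝ (fun x => φ (1, x)) (orbitAverage φ f 1) n = orbitAverage φ f n := by
  have h_iter (k : ℕ) (x : X) : (fun x => φ (1, x))^[k] x = φ (k, x) := by
    induction k with
    | zero => simp [hφ_zero]
    | succ k ih =>
      rw [Function.iterate_succ_apply', ih, ← hφ_add, Nat.cast_succ, add_comm]
  ext x
  have hf_int (a b : ℝ) : IntervalIntegrable (fun s => f (φ (s, x))) volume a b :=
    Continuous.intervalIntegrable (by fun_prop) a b
  have hadj := intervalIntegral.sum_integral_adjacent_intervals (μ := volume)
    (f := fun s => f (φ (s, x))) (a := fun k : ℕ => (k : ℝ)) (n := n) fun k _ => hf_int _ _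
  rw [Nat.cast_zero] at hadj
  simp only [birkhoffAverage, birkhoffSum, orbitAverage, smul_eq_mul, h_iter, inv_one, one_mul,
    ← hφ_add, ← hadj]
  congr 1
  refine Finset.sum_congr rfl fun k _ => ?_
  rw [intervalIntegral.integral_comp_add_right (fun s => f (φ (s, x)))]
  simp [add_comm]

theorem tendsto_orbitAverage_sub (hφ_cont : Continuous φ)
    (hφ_add : ∀ s t x, φ (s + t, x) = φ (s, φ (t, x))) {f : X → ℝ} (hf : Continuous f)
    {C : ℝ} (hC : ∀ x, |f x| ≤ C) (t : ℝ) (x : X) :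
    Tendsto (fun T => orbitAverage φ f T (φ (t, x)) - orbitAverage φ f T x) atTop (𝓝 0) := by
  have hf_int (a b : ℝ) : IntervalIntegrable (fun s => f (φ (s, x))) volume a b :=
    Continuous.intervalIntegrable (by fun_prop) a b
  have hbound (a b : ℝ) : ‖∫ s in a..b, f (φ (s, x))‖ ≤ C * |b - a| :=
    intervalIntegral.norm_integral_le_of_norm_le_const fun s _ => hC _
  have hlim : Tendsto (fun T : ℝ => |T|⁻¹ * (2 * (C * |t|))) atTop (𝓝 0) := by
    simpa using (tendsto_inv_atTop_zero.comp tendsto_abs_atTop_atTop).mul_const (2 * (C * |t|))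
  refine squeeze_zero_norm (fun T => ?_) hlim
  have hshift : (∫ s in (0 : ℝ)..T, f (φ (s, φ (t, x)))) - ∫ s in (0 : ℝ)..T, f (φ (s, x)) =
      (∫ s in T..(T + t), f (φ (s, x))) - ∫ s in (0 : ℝ)..t, f (φ (s, x)) := by
    simp only [← hφ_add]
    rw [intervalIntegral.integral_comp_add_right (fun s => f (φ (s, x))), zero_add,
      ← intervalIntegral.integral_interval_sub_left (hf_int 0 (T + t)) (hf_int 0 t),
      ← intervalIntegral.integral_interval_sub_left (hf_int 0 (T + t)) (hf_int 0 T)]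
    ring
  rw [orbitAverage, orbitAverage, ← mul_sub, hshift, norm_mul, norm_inv, Real.norm_eq_abs,
    Real.norm_eq_abs]
  refine mul_le_mul_of_nonneg_left ((abs_sub _ _).trans ?_) (by positivity)
  have h₁ := hbound T (T + t)
  have h₂ := hbound 0 t
  simp only [add_sub_cancel_left, sub_zero, Real.norm_eq_abs] at h₁ h₂
  linarith

variable [MeasurableSpace X] [BorelSpace X]

/-- The occupation measure of the orbit segment of `x` of length `T`. -/
abbrev occupationMeasure (φ : ℝ × X → X) (T : ℝ) (x : X) : Measure X :=
  Measure.map (fun s : ℝ => φ (s, x))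
    (ENNReal.ofReal (1 / T) • (volume.restrict (Set.Icc (0 : ℝ) T)))

theorem isProbabilityMeasure_occupationMeasure (hφ_cont : Continuous φ) {T : ℝ} (hT : 0 < T)
    (x : X) : IsProbabilityMeasure (occupationMeasure φ T x) := by
  have : IsProbabilityMeasure
      (ENNReal.ofReal (1 / T) • (volume.restrict (Set.Icc (0 : ℝ) T))) := by
    constructor
    rw [Measure.smul_apply, Measure.restrict_apply_univ, Real.volume_Icc, smul_eq_mul,
      ← ENNReal.ofReal_mul (by positivity), sub_zero, one_div_mul_cancel hT.ne',
      ENNReal.ofReal_one]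
  exact Measure.isProbabilityMeasure_map (by fun_prop)

theorem integral_occupationMeasure (hφ_cont : Continuous φ) {f : X → ℝ} (hf : Continuous f)
    {T : ℝ} (hT : 0 < T) (x : X) :
    ∫ y, f y ∂(occupationMeasure φ T x) = orbitAverage φ f T x := by
  rw [integral_map (by fun_prop) hf.aestronglyMeasurable, integral_smul_measure,
    integral_Icc_eq_integral_Ioc, ← intervalIntegral.integral_of_le hT.le,
    ENNReal.toReal_ofReal (by positivity), smul_eq_mul, one_div, orbitAverage]

variable [SecondCountableTopology X] {μ : Measure X} [IsProbabilityMeasure μ]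

theorem integral_orbitAverage (hφ_cont : Continuous φ)
    (hμ_inv : ∀ s : ℝ, Measure.map (fun x => φ (s, x)) μ = μ)
    (f : BoundedContinuousFunction X ℝ) {T : ℝ} (hT : T ≠ 0) :
    ∫ x, orbitAverage φ f T x ∂μ = ∫ x, f x ∂μ := by
  have hinv (s : ℝ) : ∫ x, f (φ (s, x)) ∂μ = ∫ x, f x ∂μ := by
    conv_rhs => rw [← hμ_inv s]
    rw [integral_map (by fun_prop) (by fun_prop)]
  have : IsFiniteMeasure (volume.restrict (Set.uIoc 0 T)) := ⟨by simp [Set.uIoc]⟩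
  have hf_int : Integrable (Function.uncurry fun s x => f (φ (s, x)))
      ((volume.restrict (Set.uIoc 0 T)).prod μ) :=
    Integrable.of_bound (Continuous.aestronglyMeasurable (by fun_prop)) ‖f‖
      (Eventually.of_forall fun p => f.norm_coe_le_norm _)
  simp only [orbitAverage]
  rw [integral_const_mul, ← intervalIntegral_integral_swap hf_int]
  simp [hinv, hT]

/-- The time averages of a bounded continuous function along an ergodic flow converge in measure
to its space average. -/
theorem tendstoInMeasure_orbitAverage (hφ_cont : Continuous φ) (hφ_zero : ∀ x, φ (0, x) = x)
    (hφ_add : ∀ s t x, φ (s + t, x) = φ (s, φ (t, x)))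
    (hμ_inv : ∀ s : ℝ, Measure.map (fun x => φ (s, x)) μ = μ)
    (hμ_erg : ∀ A : Set X, MeasurableSet A →
      (∀ s : ℝ, (fun x => φ (s, x)) ⁻¹' A = A) → μ A = 0 ∨ μ A = 1)
    (f : BoundedContinuousFunction X ℝ) :
    TendstoInMeasure μ (fun n : ℕ => orbitAverage φ f n) atTop (fun _ => ∫ x, f x ∂μ) := by
  have hcont (T : ℝ) : Continuous (orbitAverage φ f T) :=
    continuous_orbitAverage hφ_cont f.continuous T
  have hbound (T : ℝ) (x : X) : |orbitAverage φ f T x| ≤ ‖f‖ :=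
    abs_orbitAverage_le (norm_nonneg f) (fun y => f.norm_coe_le_norm y) T x
  obtain ⟨h, hh⟩ := exists_tendstoInMeasure_birkhoffAverage
    (S := fun x => φ (1, x)) ⟨by fun_prop, hμ_inv 1⟩
    (MemLp.of_bound (hcont 1).aestronglyMeasurable ‖f‖ (Eventually.of_forall (hbound 1)))
  simp only [funext (birkhoffAverage_eq_orbitAverage hφ_cont hφ_zero hφ_add f.continuous)] at hh
  obtain ⟨ns, hns, hae⟩ := hh.exists_seq_tendsto_ae
  let H : X → ℝ := fun x => limUnder atTop fun k => orbitAverage φ f (ns k) x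
  have hH_meas : Measurable H :=
    (StronglyMeasurable.limUnder fun k => (hcont _).stronglyMeasurable).measurable
  have hH_inv (t : ℝ) (x : X) : H (φ (t, x)) = H x := by
    have hsub := (tendsto_orbitAverage_sub hφ_cont hφ_add f.continuous
      (fun y => f.norm_coe_le_norm y) t x).comp
      (tendsto_natCast_atTop_atTop.comp hns.tendsto_atTop)
    have hiff (c : ℝ) : Tendsto (fun k => orbitAverage φ f (ns k) (φ (t, x))) atTop (𝓝 c) ↔
        Tendsto (fun k => orbitAverage φ f (ns k) x) atTop (𝓝 c) :=
      ⟨fun hc => by simpa using hc.sub hsub, fun hc => by simpa using hc.add hsub⟩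
    unfold Tendsto at hiff
    simp only [H, limUnder, lim, hiff]
  obtain ⟨c, hc⟩ : ∃ c, H =ᵐ[μ] Function.const X c := by
    refine exists_eventuallyEq_const_of_forall_separating MeasurableSet fun V hV => ?_
    rcases hμ_erg (H ⁻¹' V) (hH_meas hV) fun s => by ext x; simp [hH_inv] with h0 | h1
    · exact Or.inr (measure_eq_zero_iff_ae_notMem.1 h0)
    · exact Or.inl ((mem_ae_iff_prob_eq_one (hH_meas hV)).2 h1)
  have hhc : h =ᵐ[μ] fun _ => c := by
    filter_upwards [hc, hae] with x hx hx'
    rw [← hx'.limUnder_eq]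
    exact hx
  have hlim : Tendsto (fun k => ∫ x, orbitAverage φ f (ns k) x ∂μ) atTop (𝓝 (∫ _, c ∂μ)) := by
    refine tendsto_integral_of_dominated_convergence (fun _ => ‖f‖)
      (fun k => (hcont _).aestronglyMeasurable) (integrable_const _)
      (fun k => Eventually.of_forall (hbound _)) ?_
    filter_upwards [hae, hhc] with x hx hx'
    rwa [← hx']
  have hlim' : Tendsto (fun k => ∫ x, orbitAverage φ f (ns k) x ∂μ) atTop (𝓝 (∫ x, f x ∂μ)) := by
    refine tendsto_const_nhds.congr' ?_
    filter_upwards [hns.tendsto_atTop.eventually_gt_atTop 0] with k hk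
    exact (integral_orbitAverage hφ_cont hμ_inv f (by exact_mod_cast hk.ne')).symm
  have hc_eq : c = ∫ x, f x ∂μ := by
    simpa using tendsto_nhds_unique hlim hlim'
  rw [← hc_eq]
  exact hh.congr_right hhc

end Flow

/-- In a locally compact second-countable metric space, an open set carries almost all of its mass
on the positivity set of a compactly supported continuous function. -/
theorem exists_continuous_hasCompactSupport_lt_integral {X : Type*} [MetricSpace X]
    [LocallyCompactSpace X] [SecondCountableTopology X] [MeasurableSpace X] [BorelSpace X]
    (μ : Measure X) [IsFiniteMeasure μ] {U : Set X} (hU : IsOpen U) {r : ℝ} (hr : 0 ≤ r)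
    (hrU : r < μ.real U) :
    ∃ ψ : X → ℝ, Continuous ψ ∧ HasCompactSupport ψ ∧ (∀ x, ψ x ∈ Set.Icc (0 : ℝ) 1) ∧
      r < ∫ x, ψ x ∂μ ∧ ∀ x, 0 < ψ x → x ∈ U := by
  obtain ⟨K, hKU, hK, hrK⟩ := hU.exists_lt_isCompact
    ((ENNReal.ofReal_lt_iff_lt_toReal hr (measure_ne_top μ U)).2 hrU)
  obtain ⟨ψ, hψK, hψU, hψ_supp, hψ_mem⟩ := exists_continuous_one_zero_of_isCompact hK
    hU.isClosed_compl (Set.disjoint_compl_right_iff_subset.2 hKU)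
  refine ⟨ψ, ψ.continuous, hψ_supp, hψ_mem, ?_, fun x hx => ?_⟩
  · calc r < μ.real K := (ENNReal.ofReal_lt_iff_lt_toReal hr (measure_ne_top μ K)).1 hrK
      _ = ∫ x, K.indicator 1 x ∂μ := (integral_indicator_one hK.measurableSet).symm
      _ ≤ ∫ x, ψ x ∂μ := by
        refine integral_mono ((integrable_const (1 : ℝ)).indicator hK.measurableSet)
          (ψ.continuous.integrable_of_hasCompactSupport hψ_supp) fun x => ?_
        by_cases hx : x ∈ K
        · simp [hx, hψK hx]
        · simpa [hx] using (hψ_mem x).1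
  · by_contra hxU
    exact hx.ne' (hψU hxU)

/-- Let `X` be a locally compact, second-countable metric space,
`φ : ℝ × X → X` a continuous flow, and `μ` an invariant ergodic Borel probability measure.
Then for every `ε > 0` there are `T > 0` and a continuous compactly supported
`ψ : X → [0, 1]` with `∫ ψ dμ > 1 − ε`, such that for every `x` with `ψ(x) > 0` the
occupation measure `ν_{x,T}` (the pushforward under `s ↦ φ(s, x)` of `(1/T)` times Lebesgue
measure restricted to `[0, T]`) satisfies `d_LP(ν_{x,T}, μ) < ε` in the Lévy–Prokhorov
distance. -/
theorem stmt_11 {X : Type*} [MetricSpace X] [LocallyCompactSpace X]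
    [SecondCountableTopology X] [MeasurableSpace X] [BorelSpace X]
    (φ : ℝ × X → X) (hφ_cont : Continuous φ)
    (hφ_zero : ∀ x, φ (0, x) = x)
    (hφ_add : ∀ s t x, φ (s + t, x) = φ (s, φ (t, x)))
    (μ : Measure X) [IsProbabilityMeasure μ]
    (hμ_inv : ∀ s : ℝ, Measure.map (fun x => φ (s, x)) μ = μ)
    (hμ_erg : ∀ A : Set X, MeasurableSet A →
      (∀ s : ℝ, (fun x => φ (s, x)) ⁻¹' A = A) → μ A = 0 ∨ μ A = 1)
    (ε : ℝ) (hε : 0 < ε) :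
    ∃ T > (0 : ℝ), ∃ ψ : X → ℝ,
      Continuous ψ ∧ HasCompactSupport ψ ∧ (∀ x, ψ x ∈ Set.Icc (0 : ℝ) 1) ∧
      (∫ x, ψ x ∂μ) > 1 - ε ∧
      ∀ x : X, 0 < ψ x →
        levyProkhorovDist
          (Measure.map (fun s : ℝ => φ (s, x))
            (ENNReal.ofReal (1 / T) • (volume.restrict (Set.Icc (0 : ℝ) T))))
          μ < ε := by
  let μ' : ProbabilityMeasure X := ⟨μ, inferInstance⟩
  let P (n : ℕ) (x : X) : ProbabilityMeasure X := ⟨occupationMeasure φ (n + 1 : ℕ) x,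
    isProbabilityMeasure_occupationMeasure hφ_cont (by positivity) x⟩
  have hP (f : BoundedContinuousFunction X ℝ) (n : ℕ) (x : X) :
      ∫ y, f y ∂(P n x : Measure X) = orbitAverage φ f (n + 1 : ℕ) x :=
    integral_occupationMeasure hφ_cont f.continuous (by positivity) x
  have hP_cont (n : ℕ) : Continuous (P n) := by
    rw [continuous_iff_continuousAt]
    intro x
    refine ProbabilityMeasure.tendsto_iff_forall_integral_tendsto.2 fun f => ?_
    simp only [hP]
    exact (continuous_orbitAverage hφ_cont f.continuous _).tendsto x
  let D : Set (ProbabilityMeasure X) :=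
    LevyProkhorov.ofMeasure ⁻¹' Metric.ball (LevyProkhorov.ofMeasure μ') ε
  have hD_open : IsOpen D :=
    Metric.isOpen_ball.preimage LevyProkhorov.continuous_ofMeasure_probabilityMeasure
  have hD : D ∈ 𝓝 μ' := hD_open.mem_nhds (Metric.mem_ball_self hε)
  have hlim : Tendsto (fun n => μ {x | P n x ∉ D}) atTop (𝓝 0) := by
    refine tendsto_measure_notMem_of_forall_tendstoInMeasure (fun f => ?_) hD
    simp only [hP]
    exact (tendstoInMeasure_orbitAverage hφ_cont hφ_zero hφ_add hμ_inv hμ_erg f).comp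
      (tendsto_add_atTop_nat 1)
  obtain ⟨n, hn⟩ := (hlim.eventually_lt_const
    (ENNReal.ofReal_pos.2 (lt_min hε zero_lt_one))).exists
  have hU : IsOpen {x | P n x ∈ D} := hD_open.preimage (hP_cont n)
  have hμU : 1 - min ε 1 < μ.real {x | P n x ∈ D} := by
    have hcompl : μ.real {x | P n x ∈ D}ᶜ < min ε 1 :=
      (ENNReal.lt_ofReal_iff_toReal_lt (measure_ne_top μ _)).1 hn
    rw [probReal_compl_eq_one_sub hU.measurableSet] at hcompl
    linarith
  obtain ⟨ψ, hψ_cont, hψ_supp, hψ_mem, hψ_int, hψ⟩ :=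
    exists_continuous_hasCompactSupport_lt_integral μ hU (by simp) hμU
  exact ⟨(n + 1 : ℕ), by positivity, ψ, hψ_cont, hψ_supp, hψ_mem,
    lt_of_le_of_lt (by gcongr; exact min_le_left _ _) hψ_int, fun x hx => hψ x hx⟩
end
end

section
/- Let ε ∈ (0, 1) satisfy ε + √ε < 1, let L ≥ 1 and N ≥ 1 be integers, and let S₀, S₁, …, S_{L−1} ⊆ [0, 1] be Lebesgue-measurable sets, each of Lebesgue measure at least 1 − ε. Partition [0, 1] into the N intervals I_j = [(j−1)/N, j/N], 1 ≤ j ≤ N. Then there exists an index j such that I_j ∩ S₀ ≠ ∅ and Σ_{ℓ=0}^{L−1} λ(I_j ∩ S_ℓ) ≥ (1 − √ε)·L/N, where λ denotes Lebesgue measure; consequently, for this j and every α ∈ (0, 1), the number of indices ℓ ∈ {0, …, L−1} with λ(I_j ∩ S_ℓ) < (1 − α)/N is at most √ε·L/α. -/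
noncomputable section

open MeasureTheory

/-- The `j`-th of the `N` closed intervals of length `1 / N` partitioning `[0, 1]`, `1 ≤ j ≤ N`. -/
abbrev gridInterval (N j : ℕ) : Set ℝ := Set.Icc (((j : ℝ) - 1) / N) ((j : ℝ) / N)

lemma measureReal_gridInterval_inter_le (N j : ℕ) (T : Set ℝ) :
    volume.real (gridInterval N j ∩ T) ≤ 1 / N := by
  refine (measureReal_mono Set.inter_subset_left (by simp)).trans ?_
  have h : (j : ℝ) / N - ((j : ℝ) - 1) / N = 1 / N := by ring
  rw [Real.volume_real_Icc, h, max_eq_left (by positivity)]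

lemma Icc_subset_iUnion_gridInterval {N : ℕ} (hN : 1 ≤ N) :
    Set.Icc (0 : ℝ) 1 ⊆ ⋃ j ∈ Finset.Icc 1 N, gridInterval N j := by
  intro x hx
  have hN' : (0 : ℝ) < N := by exact_mod_cast hN
  simp only [Set.mem_iUnion, Finset.mem_Icc, exists_prop]
  rcases hx.1.eq_or_lt with rfl | hx0
  · exact ⟨1, ⟨le_rfl, hN⟩, by simp⟩
  · refine ⟨⌈x * N⌉₊, ⟨Nat.one_le_ceil_iff.2 (by positivity), ?_⟩, ?_, ?_⟩
    · exact Nat.ceil_le.2 (mul_le_of_le_one_left hN'.le hx.2)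
    · rw [div_le_iff₀ hN']
      linarith [Nat.ceil_lt_add_one (a := x * N) (by positivity)]
    · rw [le_div_iff₀ hN']
      exact Nat.le_ceil _

lemma measureReal_le_sum_gridInterval_inter {N : ℕ} (hN : 1 ≤ N) {T : Set ℝ}
    (hT : T ⊆ Set.Icc 0 1) :
    volume.real T ≤ ∑ j ∈ Finset.Icc 1 N, volume.real (gridInterval N j ∩ T) := by
  have hcover : T ⊆ ⋃ j ∈ Finset.Icc 1 N, gridInterval N j ∩ T := by
    rw [← Set.iUnion₂_inter]
    exact Set.subset_inter (hT.trans (Icc_subset_iUnion_gridInterval hN)) subset_rfl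
  have hfin : volume (⋃ j ∈ Finset.Icc 1 N, gridInterval N j ∩ T) ≠ ⊤ := by
    refine measure_ne_top_of_subset ?_ (measure_Icc_lt_top (a := (0 : ℝ)) (b := 1)).ne
    exact Set.iUnion₂_subset fun _ _ => Set.inter_subset_right.trans hT
  exact (measureReal_mono hcover hfin).trans (measureReal_biUnion_finset_le _ _)

/-- If `f ≤ c` on `s` and `f` averages at least `(1 - δ) * c` over `s`, then `f < (1 - α) * c`
happens at most `δ * #s / α` times. -/
lemma card_filter_lt_le_of_le_sum {ι : Type*} (s : Finset ι) (f : ι → ℝ) {c δ α : ℝ}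
    (hc : 0 < c) (hα : 0 < α) (hf : ∀ i ∈ s, f i ≤ c)
    (hsum : (1 - δ) * s.card * c ≤ ∑ i ∈ s, f i) :
    ((s.filter fun i => f i < (1 - α) * c).card : ℝ) ≤ δ * s.card / α := by
  have h : ∑ i ∈ s, f i ≤ ∑ i ∈ s, (c - if f i < (1 - α) * c then α * c else 0) := by
    refine Finset.sum_le_sum fun i hi => ?_
    split_ifs with hlt
    · linarith
    · linarith [hf i hi]
  rw [Finset.sum_sub_distrib, ← Finset.sum_filter, Finset.sum_const, Finset.sum_const,
    nsmul_eq_mul, nsmul_eq_mul] at h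
  rw [le_div_iff₀ hα]
  refine le_of_mul_le_mul_right ?_ hc
  linarith

/-- Let `ε ∈ (0,1)` with `ε + √ε < 1`, let `L, N ≥ 1` be integers, and let
`S₀, …, S_{L−1} ⊆ [0,1]` be measurable sets, each of Lebesgue measure at least `1 − ε`.
Partition `[0,1]` into the `N` intervals `I_j = [(j−1)/N, j/N]`, `1 ≤ j ≤ N`. Then there is an
index `j` with `I_j ∩ S₀ ≠ ∅` and `Σ_{ℓ<L} λ(I_j ∩ S_ℓ) ≥ (1 − √ε)·L/N`; consequently, for
this `j` and every `α ∈ (0,1)`, the number of `ℓ < L` with `λ(I_j ∩ S_ℓ) < (1 − α)/N` is at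
most `√ε·L/α`. -/
theorem stmt_12 (ε : ℝ) (hε0 : 0 < ε) (hε1 : ε < 1) (hsum : ε + Real.sqrt ε < 1)
    (L N : ℕ) (hL : 1 ≤ L) (hN : 1 ≤ N)
    (S : ℕ → Set ℝ)
    (hS_meas : ∀ ℓ < L, MeasurableSet (S ℓ))
    (hS_sub : ∀ ℓ < L, S ℓ ⊆ Set.Icc (0 : ℝ) 1)
    (hS_vol : ∀ ℓ < L, 1 - ε ≤ (volume (S ℓ)).toReal) :
    ∃ j : ℕ, 1 ≤ j ∧ j ≤ N ∧
      (Set.Icc (((j : ℝ) - 1) / N) ((j : ℝ) / N) ∩ S 0).Nonempty ∧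
      (1 - Real.sqrt ε) * L / N ≤
        ∑ ℓ ∈ Finset.range L,
          (volume (Set.Icc (((j : ℝ) - 1) / N) ((j : ℝ) / N) ∩ S ℓ)).toReal ∧
      ∀ α : ℝ, 0 < α → α < 1 →
        (({ℓ : ℕ | ℓ < L ∧
            (volume (Set.Icc (((j : ℝ) - 1) / N) ((j : ℝ) / N) ∩ S ℓ)).toReal
              < (1 - α) / N}.ncard : ℝ)) ≤ Real.sqrt ε * L / α := by
  have hL' : (0 : ℝ) < L := by exact_mod_cast hL
  have hN' : (0 : ℝ) < N := by exact_mod_cast hN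
  have hδ : 0 < √ε := Real.sqrt_pos.2 hε0
  have hδδ : √ε * √ε = ε := Real.mul_self_sqrt hε0.le
  obtain ⟨j, hj, hne, hj_sum⟩ : ∃ j ∈ Finset.Icc 1 N, (gridInterval N j ∩ S 0).Nonempty ∧
      (1 - √ε) * L / N ≤ ∑ ℓ ∈ Finset.range L, volume.real (gridInterval N j ∩ S ℓ) := by
    by_contra! hcon
    have hpt : ∀ j ∈ Finset.Icc 1 N, √ε * L * (1 / N) ≤
        (L * (1 / N) - ∑ ℓ ∈ Finset.range L, volume.real (gridInterval N j ∩ S ℓ)) +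
          √ε * L * (1 / N - volume.real (gridInterval N j ∩ S 0)) := by
      intro j hj
      rcases (gridInterval N j ∩ S 0).eq_empty_or_nonempty with h0 | h0
      · have hle := Finset.sum_le_card_nsmul (Finset.range L)
          (fun ℓ => volume.real (gridInterval N j ∩ S ℓ)) (1 / N)
          fun ℓ _ => measureReal_gridInterval_inter_le N j (S ℓ)
        rw [Finset.card_range, nsmul_eq_mul] at hle
        rw [h0, measureReal_empty]
        linarith
      · have hlt := hcon j hj h0
        have hnonneg := mul_nonneg (mul_pos hδ hL').le
          (sub_nonneg.2 (measureReal_gridInterval_inter_le N j (S 0)))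
        have heq : (1 - √ε) * L / N = L * (1 / N) - √ε * L * (1 / N) := by ring
        linarith
    have hsum_le := Finset.sum_le_sum hpt
    have hS_sum : ∀ ℓ < L,
        1 - ε ≤ ∑ j ∈ Finset.Icc 1 N, volume.real (gridInterval N j ∩ S ℓ) := fun ℓ hℓ =>
      (hS_vol ℓ hℓ).trans (measureReal_le_sum_gridInterval_inter hN (hS_sub ℓ hℓ))
    have hS_double := Finset.card_nsmul_le_sum (Finset.range L) _ (1 - ε)
      fun ℓ hℓ => hS_sum ℓ (Finset.mem_range.1 hℓ)
    rw [Finset.sum_comm, Finset.card_range, nsmul_eq_mul] at hS_double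
    simp only [Finset.sum_add_distrib, Finset.sum_sub_distrib, ← Finset.mul_sum,
      Finset.sum_const, Nat.card_Icc, Nat.add_sub_cancel, nsmul_eq_mul,
      mul_one_div_cancel hN'.ne'] at hsum_le
    have hS0 := mul_le_mul_of_nonneg_left (hS_sum 0 hL) (mul_pos hδ hL').le
    have hlt := mul_lt_mul_of_pos_left hsum (mul_pos hδ hL')
    have hεL : √ε * L * √ε = L * ε := by linear_combination (L : ℝ) * hδδ
    linarith
  obtain ⟨hj1, hjN⟩ := Finset.mem_Icc.1 hj
  refine ⟨j, hj1, hjN, hne, hj_sum, fun α hα _ => ?_⟩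
  have hcard := card_filter_lt_le_of_le_sum (Finset.range L)
    (fun ℓ => volume.real (gridInterval N j ∩ S ℓ)) (c := 1 / N) (δ := √ε) (by positivity) hα
    (fun ℓ _ => measureReal_gridInterval_inter_le N j (S ℓ))
    (by simpa [div_eq_mul_inv] using hj_sum)
  rw [← Set.ncard_coe_finset, Finset.card_range] at hcard
  simpa [gridInterval, Measure.real, div_eq_mul_inv] using hcard
end
end
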